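/- The odd contact superalgebra bracket formula holds: for a, b ∈ 𝒪(n, n+1; t̲), [T_K(a), T_K(b)] = T_K( T_K(a)(b) − (−1)^{p(a)} 2 ∂_{2n+1}(a) b ), where T_K(a) = T_H(a) + (−1)^{p(a)} ∂_{2n+1}(a) 𝔇 + (𝔇(a) − 2a) ∂_{2n+1} and 𝔇 = Σ_{i=1}^{2n} x_i ∂_i. -/

import Mathlib

open scoped Classical
noncomputable section

/-- The sign `(-1)^a` for a parity `a : ZMod 2`. -/
def sgn (F : Type*) [Ring F] (a : ZMod 2) : F := if a = 0 then 1 else -1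

/-- Index of a monomial `x^(α) x^u` of `𝒪(n, n'; t̲)`: a divided power exponent
`α : Fin n → ℕ` for the even variables and a subset `u` of the `n'` odd
variables. -/
abbrev SIdx (n n' : ℕ) : Type := (Fin n → ℕ) × Finset (Fin n')

/-- The superalgebra `𝒪(n, n'; t̲)` (divided powers ⊗ exterior algebra), as the
free module on the monomials (monomials with an exponent out of range multiply
to zero automatically in characteristic `p`). -/
abbrev SAlg (F : Type*) [Field F] (n n' : ℕ) : Type _ := SIdx n n' →₀ F

variable {F : Type*} [Field F] {n n' : ℕ}

/-- The Koszul sign produced when multiplying `x^u · x^v`. -/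
def mulSign (F : Type*) [Field F] {n' : ℕ} (u v : Finset (Fin n')) : F :=
  (-1 : F) ^ ((u ×ˢ v).filter fun q => q.2 < q.1).card

/-- Product of two monomials: `x^(α)x^u · x^(β)x^v = ± C(α+β, α) x^(α+β) x^{u∪v}`
if `u ∩ v = ∅`, and `0` otherwise. -/
def sMulB (q r : SIdx n n') : SAlg F n n' :=
  if Disjoint q.2 r.2 then
    (mulSign F q.2 r.2 * ∏ i, ((q.1 i + r.1 i).choose (q.1 i) : F)) •
      Finsupp.single (fun i => q.1 i + r.1 i, q.2 ∪ r.2) (1 : F)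
  else 0

/-- The (super-commutative) multiplication of `𝒪(n, n'; t̲)`. -/
def sMul (f g : SAlg F n n') : SAlg F n n' :=
  f.sum fun q c => g.sum fun r d => (c * d) • sMulB q r

/-- The even partial derivative `∂_i`, `i ∈ {1, …, n}`: `∂_i(x^(α)) = x^(α-ε_i)`. -/
def De (i : Fin n) (f : SAlg F n n') : SAlg F n n' :=
  f.sum fun q c =>
    if 0 < q.1 i then Finsupp.single (Function.update q.1 i (q.1 i - 1), q.2) c
    else 0

/-- The odd partial derivative `∂_j` with respect to the `j`-th odd variable. -/
def Do (j : Fin n') (f : SAlg F n n') : SAlg F n n' :=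
  f.sum fun q c =>
    if j ∈ q.2 then
      ((-1 : F) ^ (q.2.filter fun k => k < j).card * c) •
        Finsupp.single (q.1, q.2.erase j) (1 : F)
    else 0

/-- `f` is ℤ₂-homogeneous of parity `c`. -/
def IsHomog (c : ZMod 2) (f : SAlg F n n') : Prop :=
  ∀ q ∈ f.support, ((q.2.card : ZMod 2) = c)

/-- All exponents appearing in `f` are bounded by `π_i = p^{t_i} - 1`, i.e. `f`
lies in the truncated algebra `𝒪(n, n'; t̲)`. -/
def Bounded (p : ℕ) (t : Fin n → ℕ) (f : SAlg F n n') : Prop :=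
  ∀ q ∈ f.support, ∀ i, Prod.fst q i ≤ p ^ t i - 1

/-- `T_H(a)`, for `a` homogeneous of parity `pa`, as an operator on
`𝒪(n, n; t̲)`:  `T_H(a) = Σ_{i=1}^{2n} (-1)^{p(∂_i) p(a)} ∂_i(a) ∂_{i'}`. -/
def TH (pa : ZMod 2) (a b : SAlg F n n) : SAlg F n n :=
  (∑ i : Fin n, sMul (De i a) (Do i b)) +
    sgn F pa • ∑ i : Fin n, sMul (Do i a) (De i b)


/-- `T_H(a)` on `𝒪(n, n+1; t̲)` (only the first `2n` variables are involved). -/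
def TH' (pa : ZMod 2) (a b : SAlg F n (n + 1)) : SAlg F n (n + 1) :=
  (∑ i : Fin n, sMul (De i a) (Do i.castSucc b)) +
    sgn F pa • ∑ i : Fin n, sMul (Do i.castSucc a) (De i b)

/-- The odd partial derivative `∂_{2n+1}` with respect to the last odd variable. -/
def Dlast (a : SAlg F n (n + 1)) : SAlg F n (n + 1) := Do (Fin.last n) a

/-- The degree operator `𝔇 = Σ_{i=1}^{2n} x_i ∂_i` on `𝒪(n, n+1; t̲)`. -/
def Deg (b : SAlg F n (n + 1)) : SAlg F n (n + 1) :=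
  (∑ i : Fin n,
      sMul (Finsupp.single (fun j => if j = i then 1 else 0, (∅ : Finset (Fin (n + 1)))) (1 : F))
        (De i b)) +
    ∑ i : Fin n,
      sMul (Finsupp.single ((fun _ => 0 : Fin n → ℕ), {i.castSucc}) (1 : F))
        (Do i.castSucc b)

/-- `T_K(a) = T_H(a) + (-1)^{p(a)} ∂_{2n+1}(a) 𝔇 + (𝔇(a) - 2a) ∂_{2n+1}` as an
operator on `𝒪(n, n+1; t̲)`, for `a` homogeneous of parity `pa`. -/
def TK (pa : ZMod 2) (a b : SAlg F n (n + 1)) : SAlg F n (n + 1) :=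
  TH' pa a b + sgn F pa • sMul (Dlast a) (Deg b) + sMul (Deg a - 2 • a) (Dlast b)

/-- Extension by zero of `mulSign` to pairs that are not disjoint. -/
def koszul (F : Type*) [Field F] {m : ℕ} (u v : Finset (Fin m)) : F :=
  if Disjoint u v then mulSign F u v else 0

section signs

variable {m : ℕ}

lemma mulSign_mul_self (u v : Finset (Fin m)) : mulSign F u v * mulSign F u v = 1 := by
  unfold mulSign
  rw [← pow_add, ← two_mul, pow_mul]
  simp

lemma mulSign_union_left {u v : Finset (Fin m)} (h : Disjoint u v) (w : Finset (Fin m)) :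
    mulSign F (u ∪ v) w = mulSign F u w * mulSign F v w := by
  unfold mulSign
  rw [← pow_add, Finset.union_product, Finset.filter_union, Finset.card_union_of_disjoint]
  refine Finset.disjoint_filter_filter ?_
  rw [Finset.disjoint_product]
  exact Or.inl h

lemma mulSign_union_right {v w : Finset (Fin m)} (h : Disjoint v w) (u : Finset (Fin m)) :
    mulSign F u (v ∪ w) = mulSign F u v * mulSign F u w := by
  unfold mulSign
  rw [← pow_add, Finset.product_union, Finset.filter_union, Finset.card_union_of_disjoint]
  refine Finset.disjoint_filter_filter ?_
  rw [Finset.disjoint_product]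
  exact Or.inr h

lemma mulSign_swap {u v : Finset (Fin m)} (h : Disjoint u v) :
    mulSign F u v * mulSign F v u = (-1) ^ (u.card * v.card) := by
  unfold mulSign
  have hswap : ((v ×ˢ u).filter fun q => q.2 < q.1).card =
      ((u ×ˢ v).filter fun q => ¬ q.2 < q.1).card := by
    refine Finset.card_bij' (fun q _ => q.swap) (fun q _ => q.swap) ?_ ?_ ?_ ?_
    · rintro ⟨i, j⟩ hq
      simp only [Finset.mem_filter, Finset.mem_product, Prod.swap] at hq ⊢
      exact ⟨⟨hq.1.2, hq.1.1⟩, not_lt.2 hq.2.le⟩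
    · rintro ⟨i, j⟩ hq
      simp only [Finset.mem_filter, Finset.mem_product, Prod.swap] at hq ⊢
      refine ⟨⟨hq.1.2, hq.1.1⟩, lt_of_le_of_ne (not_lt.1 hq.2) ?_⟩
      exact fun hij => Finset.disjoint_left.1 h hq.1.1 (hij ▸ hq.1.2)
    · simp
    · simp
  rw [hswap, ← pow_add, Finset.card_filter_add_card_filter_not, Finset.card_product]

lemma mulSign_empty_left (v : Finset (Fin m)) : mulSign F ∅ v = 1 := by
  simp [mulSign]

lemma mulSign_singleton (j : Fin m) (u : Finset (Fin m)) :
    mulSign F {j} u = (-1) ^ (u.filter fun k => k < j).card := by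
  unfold mulSign
  congr 1
  rw [Finset.singleton_product, Finset.filter_map, Finset.card_map]
  rfl

lemma mulSign_singleton_insert (j : Fin m) (u : Finset (Fin m)) :
    mulSign F {j} (insert j u) = mulSign F {j} u := by
  rw [mulSign_singleton, mulSign_singleton, Finset.filter_insert, if_neg (lt_irrefl j)]

lemma koszul_assoc (u v w : Finset (Fin m)) :
    koszul F u v * koszul F (u ∪ v) w = koszul F v w * koszul F u (v ∪ w) := by
  unfold koszul
  simp only [Finset.disjoint_union_left, Finset.disjoint_union_right]
  by_cases h1 : Disjoint u v <;> by_cases h2 : Disjoint v w <;> by_cases h3 : Disjoint u w <;>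
    simp [h1, h2, h3]
  rw [mulSign_union_left h1, mulSign_union_right h2]
  ring

lemma koszul_comm (u v : Finset (Fin m)) :
    koszul F u v = (-1) ^ (u.card * v.card) * koszul F v u := by
  unfold koszul
  by_cases h : Disjoint u v
  · rw [if_pos h, if_pos h.symm, ← mulSign_swap h, mul_assoc, mulSign_mul_self, mul_one]
  · rw [if_neg h, if_neg fun h' => h h'.symm, mul_zero]

lemma koszul_insert_left {j : Fin m} {u v : Finset (Fin m)} (hu : j ∉ u) (hv : j ∉ v) :
    mulSign F {j} (u ∪ v) * koszul F (insert j u) v = mulSign F {j} u * koszul F u v := by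
  unfold koszul
  simp only [Finset.disjoint_insert_left]
  by_cases h : Disjoint u v
  · rw [if_pos ⟨hv, h⟩, if_pos h, mulSign_union_right h, Finset.insert_eq,
      mulSign_union_left (Finset.disjoint_singleton_left.2 hu)]
    linear_combination (mulSign F {j} u * mulSign F u v) * mulSign_mul_self (F := F) {j} v
  · simp [h]

lemma koszul_insert_right {j : Fin m} {u v : Finset (Fin m)} (hu : j ∉ u) (hv : j ∉ v) :
    mulSign F {j} (u ∪ v) * koszul F u (insert j v) =
      (-1) ^ u.card * (mulSign F {j} v * koszul F u v) := by
  unfold koszul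
  simp only [Finset.disjoint_insert_right]
  by_cases h : Disjoint u v
  · have hs := mulSign_swap (F := F) (Finset.disjoint_singleton_left.2 hu)
    rw [Finset.card_singleton, one_mul] at hs
    rw [if_pos ⟨hu, h⟩, if_pos h, mulSign_union_right h, Finset.insert_eq,
      mulSign_union_right (Finset.disjoint_singleton_left.2 hv), ← hs]
    ring
  · simp [h]

lemma koszul_insert_swap {j : Fin m} {u v : Finset (Fin m)} (hu : j ∉ u) (hv : j ∉ v) :
    mulSign F {j} u * koszul F u (insert j v) =
      (-1) ^ u.card * (mulSign F {j} v * koszul F (insert j u) v) := by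
  unfold koszul
  simp only [Finset.disjoint_insert_right, Finset.disjoint_insert_left]
  by_cases h : Disjoint u v
  · have hs := mulSign_swap (F := F) (Finset.disjoint_singleton_left.2 hu)
    rw [Finset.card_singleton, one_mul] at hs
    rw [if_pos ⟨hu, h⟩, if_pos ⟨hv, h⟩, Finset.insert_eq, Finset.insert_eq,
      mulSign_union_right (Finset.disjoint_singleton_left.2 hv),
      mulSign_union_left (Finset.disjoint_singleton_left.2 hu), ← hs]
    linear_combination (-(mulSign F {j} u * mulSign F u {j} * mulSign F u v)) *
      mulSign_mul_self (F := F) {j} v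
  · simp [h]

end signs

/-- The monomial with index `q`. -/
abbrev mono (F : Type*) [Field F] {n n' : ℕ} (q : SIdx n n') : SAlg F n n' := Finsupp.single q 1

/-- The multiplication of `SAlg` as a bilinear map. -/
def sMulL : SAlg F n n' →ₗ[F] SAlg F n n' →ₗ[F] SAlg F n n' :=
  Finsupp.lsum F fun q => LinearMap.toSpanSingleton F _
    (Finsupp.lsum F fun r => LinearMap.toSpanSingleton F _ (sMulB q r))

lemma sMulL_apply (f g : SAlg F n n') : sMulL f g = sMul f g := by
  simp only [sMulL, sMul, Finsupp.lsum_apply, Finsupp.sum, LinearMap.toSpanSingleton_apply,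
    LinearMap.sum_apply, LinearMap.smul_apply, Finset.smul_sum, mul_smul]

/-- `De i` as a linear map. -/
def DeL (i : Fin n) : SAlg F n n' →ₗ[F] SAlg F n n' :=
  Finsupp.lsum F fun q => LinearMap.toSpanSingleton F _
    (if 0 < q.1 i then mono F (Function.update q.1 i (q.1 i - 1), q.2) else 0)

lemma DeL_apply (i : Fin n) (f : SAlg F n n') : DeL i f = De i f := by
  simp only [DeL, De, Finsupp.lsum_apply, Finsupp.sum, LinearMap.toSpanSingleton_apply, smul_ite,
    smul_zero, Finsupp.smul_single, smul_eq_mul, mul_one]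

/-- `Do j` as a linear map. -/
def DoL (j : Fin n') : SAlg F n n' →ₗ[F] SAlg F n n' :=
  Finsupp.lsum F fun q => LinearMap.toSpanSingleton F _
    (if j ∈ q.2 then mulSign F {j} q.2 • mono F (q.1, q.2.erase j) else 0)

lemma DoL_apply (j : Fin n') (f : SAlg F n n') : DoL j f = Do j f := by
  simp only [DoL, Do, Finsupp.lsum_apply, Finsupp.sum, LinearMap.toSpanSingleton_apply, smul_ite,
    smul_zero, smul_smul, mulSign_singleton, mul_comm]

/-- `Deg` as a linear map. -/
def DegL : SAlg F n (n + 1) →ₗ[F] SAlg F n (n + 1) :=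
  (∑ i : Fin n, (sMulL (mono F (fun j => if j = i then 1 else 0, ∅))).comp (DeL i)) +
    ∑ i : Fin n, (sMulL (mono F ((fun _ => 0), {i.castSucc}))).comp (DoL i.castSucc)

lemma DegL_apply (f : SAlg F n (n + 1)) : DegL f = Deg f := by
  simp [DegL, Deg, sMulL_apply, DeL_apply, DoL_apply]

section monomials

lemma sMul_mono (q r : SIdx n n') :
    sMul (mono F q) (mono F r) =
      (koszul F q.2 r.2 * ∏ i, ((q.1 i + r.1 i).choose (q.1 i) : F)) •
        mono F (q.1 + r.1, q.2 ∪ r.2) := by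
  have h : sMul (mono F q) (mono F r) = sMulB q r := by simp [sMul]
  rw [h, sMulB, koszul]
  split_ifs
  · rfl
  · simp

lemma De_mono (i : Fin n) (q : SIdx n n') :
    De i (mono F q) =
      (if 0 < q.1 i then 1 else 0 : F) • mono F (Function.update q.1 i (q.1 i - 1), q.2) := by
  simp [De]

lemma Do_mono (j : Fin n') (q : SIdx n n') :
    Do j (mono F q) =
      (if j ∈ q.2 then mulSign F {j} q.2 else 0) • mono F (q.1, q.2.erase j) := by
  rw [Do, Finsupp.sum_single_index (by simp)]
  split_ifs <;> simp [mulSign_singleton]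

lemma mono_induction {P : SAlg F n n' → Prop} (hadd : ∀ f g, P f → P g → P (f + g))
    (hsmul : ∀ (c : F) f, P f → P (c • f)) (hmono : ∀ q, P (mono F q)) (f : SAlg F n n') :
    P f := by
  induction f using Finsupp.induction_linear with
  | zero => simpa using hsmul 0 _ (hmono (0, ∅))
  | add f g hf hg => exact hadd f g hf hg
  | single q c => simpa using hsmul c _ (hmono q)

lemma IsHomog.induction {c : ZMod 2} {P : SAlg F n n' → Prop} (hzero : P 0)
    (hadd : ∀ f g, P f → P g → P (f + g)) (hsmul : ∀ (d : F) f, P f → P (d • f))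
    (hmono : ∀ q : SIdx n n', (q.2.card : ZMod 2) = c → P (mono F q))
    {f : SAlg F n n'} (hf : IsHomog c f) : P f := by
  rw [← Finsupp.sum_single f]
  refine Finset.sum_induction _ P hadd hzero fun q hq => ?_
  simpa using hsmul (f q) _ (hmono q (hf q hq))

end monomials

section linearity

@[simp] lemma sMul_add (f g h : SAlg F n n') : sMul f (g + h) = sMul f g + sMul f h := by
  simp only [← sMulL_apply, map_add]

@[simp] lemma sMul_sub (f g h : SAlg F n n') : sMul f (g - h) = sMul f g - sMul f h := by
  simp only [← sMulL_apply, map_sub]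

@[simp] lemma sMul_neg (f g : SAlg F n n') : sMul f (-g) = -sMul f g := by
  simp only [← sMulL_apply, map_neg]

@[simp] lemma sMul_zero (f : SAlg F n n') : sMul f 0 = 0 := by
  simp only [← sMulL_apply, map_zero]

@[simp] lemma sMul_smul (c : F) (f g : SAlg F n n') : sMul f (c • g) = c • sMul f g := by
  simp only [← sMulL_apply, map_smul]

@[simp] lemma add_sMul (f g h : SAlg F n n') : sMul (f + g) h = sMul f h + sMul g h := by
  simp only [← sMulL_apply, map_add, LinearMap.add_apply]

@[simp] lemma sub_sMul (f g h : SAlg F n n') : sMul (f - g) h = sMul f h - sMul g h := by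
  simp only [← sMulL_apply, map_sub, LinearMap.sub_apply]

@[simp] lemma neg_sMul (f g : SAlg F n n') : sMul (-f) g = -sMul f g := by
  simp only [← sMulL_apply, map_neg, LinearMap.neg_apply]

@[simp] lemma zero_sMul (f : SAlg F n n') : sMul 0 f = 0 := by
  simp only [← sMulL_apply, map_zero, LinearMap.zero_apply]

@[simp] lemma smul_sMul (c : F) (f g : SAlg F n n') : sMul (c • f) g = c • sMul f g := by
  simp only [← sMulL_apply, map_smul, LinearMap.smul_apply]

lemma sMul_sum {ι : Type*} (s : Finset ι) (f : SAlg F n n') (g : ι → SAlg F n n') :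
    sMul f (∑ i ∈ s, g i) = ∑ i ∈ s, sMul f (g i) := by
  simp only [← sMulL_apply, map_sum]

lemma sum_sMul {ι : Type*} (s : Finset ι) (f : ι → SAlg F n n') (g : SAlg F n n') :
    sMul (∑ i ∈ s, f i) g = ∑ i ∈ s, sMul (f i) g := by
  simp only [← sMulL_apply, map_sum, LinearMap.sum_apply]

@[simp] lemma De_add (i : Fin n) (f g : SAlg F n n') : De i (f + g) = De i f + De i g := by
  simp only [← DeL_apply, map_add]

@[simp] lemma De_smul (i : Fin n) (c : F) (f : SAlg F n n') : De i (c • f) = c • De i f := by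
  simp only [← DeL_apply, map_smul]

lemma De_sum {ι : Type*} (s : Finset ι) (i : Fin n) (f : ι → SAlg F n n') :
    De i (∑ k ∈ s, f k) = ∑ k ∈ s, De i (f k) := by
  simp only [← DeL_apply, map_sum]

@[simp] lemma Do_add (j : Fin n') (f g : SAlg F n n') : Do j (f + g) = Do j f + Do j g := by
  simp only [← DoL_apply, map_add]

@[simp] lemma Do_sub (j : Fin n') (f g : SAlg F n n') : Do j (f - g) = Do j f - Do j g := by
  simp only [← DoL_apply, map_sub]

@[simp] lemma Do_smul (j : Fin n') (c : F) (f : SAlg F n n') : Do j (c • f) = c • Do j f := by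
  simp only [← DoL_apply, map_smul]

lemma Do_sum {ι : Type*} (s : Finset ι) (j : Fin n') (f : ι → SAlg F n n') :
    Do j (∑ k ∈ s, f k) = ∑ k ∈ s, Do j (f k) := by
  simp only [← DoL_apply, map_sum]

end linearity


section homogeneity

lemma sgn_add (a b : ZMod 2) : sgn F (a + b) = sgn F a * sgn F b := by
  have h : ∀ c : ZMod 2, c = 0 ∨ c = 1 := by decide
  have h2 : (1 + 1 : ZMod 2) = 0 := by decide
  rcases h a with rfl | rfl <;> rcases h b with rfl | rfl <;> simp [sgn, h2]

lemma sgn_natCast (k : ℕ) : sgn F (k : ZMod 2) = (-1) ^ k := by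
  induction k with
  | zero => simp [sgn]
  | succ k ih => rw [Nat.cast_succ, sgn_add, ih, pow_succ]; simp [sgn]

lemma IsHomog.zero (c : ZMod 2) : IsHomog c (0 : SAlg F n n') := by
  simp [IsHomog]

lemma IsHomog.add {c : ZMod 2} {f g : SAlg F n n'} (hf : IsHomog c f) (hg : IsHomog c g) :
    IsHomog c (f + g) := fun q hq =>
  (Finset.mem_union.1 (Finsupp.support_add hq)).elim (hf q) (hg q)

lemma IsHomog.smul {c : ZMod 2} {f : SAlg F n n'} (hf : IsHomog c f) (d : F) :
    IsHomog c (d • f) := fun q hq => hf q (Finsupp.support_smul hq)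

lemma isHomog_mono {c : ZMod 2} {q : SIdx n n'} (hq : (q.2.card : ZMod 2) = c) :
    IsHomog c (mono F q) := by
  intro r hr
  rw [Finset.mem_singleton.1 (Finsupp.support_single_subset hr), hq]

lemma IsHomog.even_deriv {c : ZMod 2} {f : SAlg F n n'} (hf : IsHomog c f) (i : Fin n) :
    IsHomog c (De i f) := by
  refine IsHomog.induction (P := fun f => IsHomog c (De i f)) ?_ ?_ ?_ ?_ hf
  · simpa [De] using IsHomog.zero c
  · intro f g hf hg; rw [De_add]; exact hf.add hg
  · intro d f hf; rw [De_smul]; exact hf.smul d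
  · intro q hq; rw [De_mono]; refine (isHomog_mono ?_).smul _; exact hq

lemma IsHomog.odd_deriv {c : ZMod 2} {f : SAlg F n n'} (hf : IsHomog c f) (j : Fin n') :
    IsHomog (c + 1) (Do j f) := by
  refine IsHomog.induction (P := fun f => IsHomog (c + 1) (Do j f)) ?_ ?_ ?_ ?_ hf
  · simpa [Do] using IsHomog.zero (c + 1)
  · intro f g hf hg; rw [Do_add]; exact hf.add hg
  · intro d f hf; rw [Do_smul]; exact hf.smul d
  · intro q hq
    rw [Do_mono]
    split_ifs with hj
    · refine (isHomog_mono ?_).smul _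
      rw [← hq, ← Finset.card_erase_add_one hj, Nat.cast_succ, add_assoc,
        show (1 + 1 : ZMod 2) = 0 by decide, add_zero]
    · rw [zero_smul]; exact IsHomog.zero _

end homogeneity

section algebra

theorem sMul_assoc (f g h : SAlg F n n') : sMul (sMul f g) h = sMul f (sMul g h) := by
  induction f using mono_induction with
  | hadd f f' hf hf' => simp only [add_sMul, hf, hf']
  | hsmul c f hf => simp only [smul_sMul, hf]
  | hmono q =>
  induction g using mono_induction with
  | hadd f f' hf hf' => simp only [add_sMul, sMul_add, hf, hf']
  | hsmul c f hf => simp only [sMul_smul, smul_sMul, hf]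
  | hmono r =>
  induction h using mono_induction with
  | hadd f f' hf hf' => simp only [sMul_add, hf, hf']
  | hsmul c f hf => simp only [sMul_smul, hf]
  | hmono s =>
  simp only [sMul_mono, smul_sMul, sMul_smul, smul_smul, add_assoc, Finset.union_assoc]
  congr 1
  have hprod : (∏ i, ((q.1 i + r.1 i).choose (q.1 i) : F)) *
        ∏ i, (((q.1 + r.1) i + s.1 i).choose ((q.1 + r.1) i) : F) =
      (∏ i, ((r.1 i + s.1 i).choose (r.1 i) : F)) *
        ∏ i, ((q.1 i + (r.1 + s.1) i).choose (q.1 i) : F) := by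
    rw [← Finset.prod_mul_distrib, ← Finset.prod_mul_distrib]
    refine Finset.prod_congr rfl fun i _ => ?_
    have h := Nat.choose_mul (n := q.1 i + (r.1 i + s.1 i)) (k := q.1 i + r.1 i) (s := q.1 i)
      (Nat.le_add_right _ _)
    simp only [Nat.add_sub_cancel_left] at h
    simp only [Pi.add_apply, add_assoc]
    rw [mul_comm]
    have hF := congrArg (Nat.cast (R := F)) h
    push_cast at hF
    linear_combination hF
  linear_combination (∏ i, ((q.1 i + r.1 i).choose (q.1 i) : F)) *
      (∏ i, (((q.1 + r.1) i + s.1 i).choose ((q.1 + r.1) i) : F)) *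
        koszul_assoc (F := F) q.2 r.2 s.2 +
    koszul F r.2 s.2 * koszul F q.2 (r.2 ∪ s.2) * hprod

theorem sMul_comm_of_isHomog {c d : ZMod 2} {f g : SAlg F n n'} (hf : IsHomog c f)
    (hg : IsHomog d g) : sMul f g = sgn F (c * d) • sMul g f := by
  refine IsHomog.induction (P := fun f => sMul f g = sgn F (c * d) • sMul g f) ?_ ?_ ?_ ?_ hf
  · simp
  · intro f g hf hg; simp [hf, hg]
  · intro d f hf; simp [hf, smul_comm d]
  intro q hq
  refine IsHomog.induction (P := fun g => sMul _ g = sgn F (c * d) • sMul g _) ?_ ?_ ?_ ?_ hg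
  · simp
  · intro f g hf hg; simp [hf, hg]
  · intro d f hf; simp [hf, smul_comm d]
  intro r hr
  rw [sMul_mono, sMul_mono, smul_smul, koszul_comm, add_comm, Finset.union_comm, ← hq, ← hr,
    ← Nat.cast_mul, sgn_natCast, mul_assoc]
  have hprod : ∏ i, ((q.1 i + r.1 i).choose (q.1 i) : F) =
      ∏ i, ((r.1 i + q.1 i).choose (r.1 i) : F) :=
    Finset.prod_congr rfl fun i _ => by rw [add_comm, Nat.choose_symm_add]
  rw [hprod]

theorem De_sMul (i : Fin n) (f g : SAlg F n n') :
    De i (sMul f g) = sMul (De i f) g + sMul f (De i g) := by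
  induction f using mono_induction with
  | hadd f f' hf hf' => simp only [De_add, add_sMul, hf, hf']; abel
  | hsmul c f hf => simp only [De_smul, smul_sMul, hf, smul_add]
  | hmono q =>
  induction g using mono_induction with
  | hadd f f' hf hf' => simp only [De_add, sMul_add, hf, hf']; abel
  | hsmul c f hf => simp only [De_smul, sMul_smul, hf, smul_add]
  | hmono r =>
  obtain ⟨α, u⟩ := q
  obtain ⟨β, v⟩ := r
  simp only [sMul_mono, De_mono, De_smul, smul_sMul, sMul_smul, smul_smul]
  have hprod : ∀ α' β' : Fin n → ℕ, (∀ k ≠ i, α' k = α k) → (∀ k ≠ i, β' k = β k) →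
      ∏ k, ((α' k + β' k).choose (α' k) : F) = ((α' i + β' i).choose (α' i) : F) *
        ∏ k ∈ Finset.univ.erase i, ((α k + β k).choose (α k) : F) := by
    intro α' β' hα hβ
    rw [← Finset.mul_prod_erase _ _ (Finset.mem_univ i)]
    congr 1
    refine Finset.prod_congr rfl fun k hk => ?_
    rw [hα k (Finset.ne_of_mem_erase hk), hβ k (Finset.ne_of_mem_erase hk)]
  rw [hprod α β (fun _ _ => rfl) (fun _ _ => rfl),
    hprod _ β (fun k hk => Function.update_of_ne hk _ _) (fun _ _ => rfl),
    hprod α _ (fun _ _ => rfl) (fun k hk => Function.update_of_ne hk _ _)]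
  have hα : 0 < α i → Function.update α i (α i - 1) + β =
      Function.update (α + β) i ((α + β) i - 1) := by
    intro h
    ext k
    rcases eq_or_ne k i with rfl | hk
    · simp only [Pi.add_apply, Function.update_self]; omega
    · simp [hk]
  have hβ : 0 < β i → α + Function.update β i (β i - 1) =
      Function.update (α + β) i ((α + β) i - 1) := by
    intro h
    ext k
    rcases eq_or_ne k i with rfl | hk
    · simp only [Pi.add_apply, Function.update_self]; omega
    · simp [hk]
  simp only [Function.update_self, Pi.add_apply] at *
  rcases Nat.eq_zero_or_pos (α i) with h1 | h1 <;> rcases Nat.eq_zero_or_pos (β i) with h2 | h2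
  · simp [h1, h2]
  · simp [h1, h2, hβ h2]
  · simp [h1, h2, hα h1]
  · rw [hα h1, hβ h2, ← add_smul]
    congr 1
    simp only [h1, h2, if_true, Nat.add_pos_left]
    obtain ⟨x, hx⟩ := Nat.exists_eq_add_of_lt h1
    obtain ⟨y, hy⟩ := Nat.exists_eq_add_of_lt h2
    have hP : ((α i + β i).choose (α i) : F) =
        ((α i - 1 + β i).choose (α i - 1) : F) + ((α i + (β i - 1)).choose (α i) : F) := by
      rw [hx, hy, ← Nat.cast_add]
      congr 1
      simp only [Nat.zero_add, Nat.add_sub_cancel]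
      rw [show x + 1 + (y + 1) = (x + (y + 1)) + 1 by omega, Nat.choose_succ_succ,
        show x + 1 + y = x + (y + 1) by omega]
    rw [hP]
    ring

lemma Do_sMul_mono (j : Fin n') (q r : SIdx n n') :
    Do j (sMul (mono F q) (mono F r)) =
      sMul (Do j (mono F q)) (mono F r) +
        (-1 : F) ^ q.2.card • sMul (mono F q) (Do j (mono F r)) := by
  obtain ⟨α, u⟩ := q
  obtain ⟨β, v⟩ := r
  simp only [sMul_mono, Do_mono, Do_smul, smul_sMul, sMul_smul, smul_smul]
  by_cases hu : j ∈ u <;> by_cases hv : j ∈ v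
  · obtain ⟨u, hju, rfl⟩ : ∃ u', j ∉ u' ∧ u = insert j u' :=
      ⟨u.erase j, Finset.notMem_erase _ _, (Finset.insert_erase hu).symm⟩
    obtain ⟨v, hjv, rfl⟩ : ∃ v', j ∉ v' ∧ v = insert j v' :=
      ⟨v.erase j, Finset.notMem_erase _ _, (Finset.insert_erase hv).symm⟩
    have h0 : koszul F (insert j u) (insert j v) = 0 :=
      if_neg fun h => Finset.disjoint_left.1 h hu hv
    simp only [hu, hv, if_true, h0, Finset.erase_insert hju, Finset.erase_insert hjv,
      mulSign_singleton_insert, Finset.card_insert_of_notMem hju, Finset.insert_union,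
      Finset.union_insert, zero_mul, zero_smul]
    rw [← add_smul, eq_comm]
    refine smul_eq_zero_of_left ?_ _
    linear_combination (∏ i, ((α i + β i).choose (α i) : F)) * koszul_insert_swap (F := F) hju hjv
  · obtain ⟨u, hju, rfl⟩ : ∃ u', j ∉ u' ∧ u = insert j u' :=
      ⟨u.erase j, Finset.notMem_erase _ _, (Finset.insert_erase hu).symm⟩
    have hj : j ∉ u ∪ v := by simp [hju, hv]
    simp only [hu, hv, if_true, if_false, Finset.erase_insert hju, Finset.insert_union,
      Finset.mem_insert_self, Finset.erase_insert hj, mulSign_singleton_insert, zero_mul,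
      mul_zero, zero_smul, add_zero]
    congr 1
    linear_combination (∏ i, ((α i + β i).choose (α i) : F)) * koszul_insert_left (F := F) hju hv
  · obtain ⟨v, hjv, rfl⟩ : ∃ v', j ∉ v' ∧ v = insert j v' :=
      ⟨v.erase j, Finset.notMem_erase _ _, (Finset.insert_erase hv).symm⟩
    have hj : j ∉ u ∪ v := by simp [hjv, hu]
    simp only [hu, hv, if_true, if_false, Finset.erase_insert hjv, Finset.union_insert,
      Finset.mem_insert_self, Finset.erase_insert hj, mulSign_singleton_insert, zero_mul,
      zero_smul, zero_add]
    congr 1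
    linear_combination (∏ i, ((α i + β i).choose (α i) : F)) * koszul_insert_right (F := F) hu hjv
  · simp [hu, hv]

end algebra

section derivations

theorem Do_sMul {c : ZMod 2} {f : SAlg F n n'} (hf : IsHomog c f) (j : Fin n')
    (g : SAlg F n n') :
    Do j (sMul f g) = sMul (Do j f) g + sgn F c • sMul f (Do j g) := by
  refine IsHomog.induction
    (P := fun f => Do j (sMul f g) = sMul (Do j f) g + sgn F c • sMul f (Do j g)) ?_ ?_ ?_ ?_ hf
  · simp [← DoL_apply]
  · intro f f' hf hf'
    simp only [Do_add, add_sMul, hf, hf', smul_add]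
    abel
  · intro d f hf
    simp only [Do_smul, smul_sMul, hf, smul_add, smul_comm d]
  intro q hq
  induction g using mono_induction with
  | hadd f f' hf hf' => simp only [Do_add, sMul_add, hf, hf', smul_add]; abel
  | hsmul d f hf => simp only [Do_smul, sMul_smul, hf, smul_add, smul_comm d]
  | hmono r => rw [Do_sMul_mono, ← hq, sgn_natCast]

theorem De_comm (i j : Fin n) (f : SAlg F n n') : De i (De j f) = De j (De i f) := by
  induction f using mono_induction with
  | hadd f f' hf hf' => simp only [De_add, hf, hf']
  | hsmul d f hf => simp only [De_smul, hf]
  | hmono q =>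
    rcases eq_or_ne i j with rfl | hij
    · rfl
    simp only [De_mono, De_smul, smul_smul, Function.update_of_ne hij,
      Function.update_of_ne hij.symm, Function.update_comm hij, mul_comm]

theorem Do_De (i : Fin n) (j : Fin n') (f : SAlg F n n') : Do j (De i f) = De i (Do j f) := by
  induction f using mono_induction with
  | hadd f f' hf hf' => simp only [De_add, Do_add, hf, hf']
  | hsmul d f hf => simp only [De_smul, Do_smul, hf]
  | hmono q => simp only [De_mono, De_smul, Do_mono, Do_smul, smul_smul, mul_comm]

theorem Do_anticomm (i j : Fin n') (f : SAlg F n n') : Do i (Do j f) = -Do j (Do i f) := by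
  induction f using mono_induction with
  | hadd f f' hf hf' => simp only [Do_add, hf, hf', neg_add]
  | hsmul d f hf => simp only [Do_smul, hf, smul_neg]
  | hmono q =>
    obtain ⟨α, u⟩ := q
    simp only [Do_mono, Do_smul, smul_smul, Finset.mem_erase]
    rcases eq_or_ne i j with rfl | hij
    · simp
    by_cases hi : i ∈ u
    swap
    · simp [hi]
    by_cases hj : j ∈ u
    swap
    · simp [hj]
    obtain ⟨v, hv, rfl⟩ : ∃ v, i ∉ v ∧ u = insert i v :=
      ⟨u.erase i, Finset.notMem_erase _ _, (Finset.insert_erase hi).symm⟩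
    obtain ⟨w, hw, rfl⟩ : ∃ w, j ∉ w ∧ v = insert j w :=
      ⟨v.erase j, Finset.notMem_erase _ _,
        (Finset.insert_erase ((Finset.mem_insert.1 hj).resolve_left hij.symm)).symm⟩
    have hiw : i ∉ w := fun h => hv (Finset.mem_insert_of_mem h)
    have hjw : j ∉ insert i w := by simp [hij.symm, hw]
    have hs := mulSign_swap (F := F) (Finset.disjoint_singleton.2 hij)
    have hmul : ∀ {k l : Fin n'}, k ∉ w → mulSign F {l} (insert k w) =
        mulSign F {l} {k} * mulSign F {l} w := fun hk => by
      rw [Finset.insert_eq, mulSign_union_right (Finset.disjoint_singleton_left.2 hk)]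
    have hji : mulSign F {j} (insert i (insert j w)) = mulSign F {j} {i} * mulSign F {j} w := by
      rw [Finset.insert_comm, mulSign_singleton_insert, hmul hiw]
    have herase : (insert i (insert j w)).erase j = insert i w := by
      rw [Finset.insert_comm, Finset.erase_insert hjw]
    rw [herase, Finset.erase_insert hv, Finset.erase_insert hiw, Finset.erase_insert hw, hji,
      mulSign_singleton_insert, mulSign_singleton_insert, mulSign_singleton_insert, hmul hw,
      ← neg_smul]
    congr 1
    simp only [Finset.card_singleton, mul_one, pow_one] at hs
    simp only [hij, hij.symm, ne_eq, not_false_eq_true, true_and, Finset.mem_insert, true_or,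
      or_true, if_true]
    have h1 := mulSign_mul_self (F := F) {i} {j}
    linear_combination (mulSign F {j} w * mulSign F {i} w) *
      (mulSign F {i} {j} * hs - mulSign F {j} {i} * h1)

theorem Do_Do_self (j : Fin n') (f : SAlg F n n') : Do j (Do j f) = 0 := by
  induction f using mono_induction with
  | hadd f f' hf hf' => simp only [Do_add, hf, hf', add_zero]
  | hsmul d f hf => simp only [Do_smul, hf, smul_zero]
  | hmono q => simp only [Do_mono, Do_smul, Finset.notMem_erase, if_false, zero_smul, smul_zero]

/-- The eigenvalue of `Deg` on the monomial with index `q`. -/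
def monoDeg (F : Type*) [Field F] {n : ℕ} (q : SIdx n (n + 1)) : F :=
  ∑ i : Fin n, ((q.1 i : F) + if i.castSucc ∈ q.2 then 1 else 0)

lemma sMul_var_De_mono (i : Fin n) (q : SIdx n n') :
    sMul (mono F (fun j => if j = i then 1 else 0, ∅)) (De i (mono F q)) =
      (q.1 i : F) • mono F q := by
  rw [De_mono, sMul_smul, sMul_mono, smul_smul]
  rcases Nat.eq_zero_or_pos (q.1 i) with h | h
  · simp [h]
  have hexp : (fun j => if j = i then 1 else 0) + Function.update q.1 i (q.1 i - 1) = q.1 := by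
    ext k
    rcases eq_or_ne k i with rfl | hk
    · simp only [Pi.add_apply, Function.update_self, if_true]; omega
    · simp [hk]
  rw [hexp, Finset.empty_union, Finset.prod_eq_single i]
  · simp only [h, if_true, koszul, Finset.disjoint_empty_left, mulSign_empty_left,
      Function.update_self, Nat.choose_one_right, one_mul]
    rw [Nat.add_sub_cancel' h]
  · intro k _ hk
    simp [hk]
  · simp

lemma sMul_var_Do_mono (j : Fin n') (q : SIdx n n') :
    sMul (mono F ((fun _ => 0), {j})) (Do j (mono F q)) =
      (if j ∈ q.2 then 1 else 0 : F) • mono F q := by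
  rw [Do_mono, sMul_smul, sMul_mono, smul_smul]
  split_ifs with h
  · have h0 : (fun _ => 0 : Fin n → ℕ) + q.1 = q.1 := zero_add _
    have hd : Disjoint {j} (q.2.erase j) :=
      Finset.disjoint_singleton_left.2 (Finset.notMem_erase _ _)
    have hs : mulSign F {j} q.2 = mulSign F {j} (q.2.erase j) := by
      conv_lhs => rw [← Finset.insert_erase h, mulSign_singleton_insert]
    rw [h0, ← Finset.insert_eq, Finset.insert_erase h, koszul, if_pos hd, hs, ← mul_assoc,
      mulSign_mul_self]
    simp
  · simp

lemma Deg_mono (q : SIdx n (n + 1)) : Deg (mono F q) = monoDeg F q • mono F q := by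
  rw [Deg, monoDeg, Finset.sum_add_distrib, add_smul, Finset.sum_smul, Finset.sum_smul]
  congr 1
  · exact Finset.sum_congr rfl fun i _ => sMul_var_De_mono i q
  · exact Finset.sum_congr rfl fun i _ => sMul_var_Do_mono i.castSucc q

@[simp] lemma Deg_add (f g : SAlg F n (n + 1)) : Deg (f + g) = Deg f + Deg g := by
  simp only [← DegL_apply, map_add]

@[simp] lemma Deg_sub (f g : SAlg F n (n + 1)) : Deg (f - g) = Deg f - Deg g := by
  simp only [← DegL_apply, map_sub]

@[simp] lemma Deg_smul (c : F) (f : SAlg F n (n + 1)) : Deg (c • f) = c • Deg f := by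
  simp only [← DegL_apply, map_smul]

lemma Deg_sum {ι : Type*} (s : Finset ι) (f : ι → SAlg F n (n + 1)) :
    Deg (∑ i ∈ s, f i) = ∑ i ∈ s, Deg (f i) := by
  simp only [← DegL_apply, map_sum]

lemma IsHomog.deg {c : ZMod 2} {f : SAlg F n (n + 1)} (hf : IsHomog c f) : IsHomog c (Deg f) := by
  refine IsHomog.induction (P := fun f => IsHomog c (Deg f)) ?_ ?_ ?_ ?_ hf
  · rw [← DegL_apply, map_zero]; exact IsHomog.zero c
  · intro f g hf hg; rw [Deg_add]; exact hf.add hg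
  · intro d f hf; rw [Deg_smul]; exact hf.smul d
  · intro q hq; rw [Deg_mono]; exact (isHomog_mono hq).smul _

theorem Deg_sMul (f g : SAlg F n (n + 1)) :
    Deg (sMul f g) = sMul (Deg f) g + sMul f (Deg g) := by
  induction f using mono_induction with
  | hadd f f' hf hf' => simp only [Deg_add, add_sMul, hf, hf']; abel
  | hsmul c f hf => simp only [Deg_smul, smul_sMul, hf, smul_add]
  | hmono q =>
  induction g using mono_induction with
  | hadd f f' hf hf' => simp only [Deg_add, sMul_add, hf, hf']; abel
  | hsmul c f hf => simp only [Deg_smul, sMul_smul, hf, smul_add]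
  | hmono r =>
  simp only [Deg_mono, smul_sMul, sMul_smul, sMul_mono, Deg_smul, smul_smul, ← add_smul]
  congr 1
  by_cases h : Disjoint q.2 r.2
  · have hdeg : monoDeg F (q.1 + r.1, q.2 ∪ r.2) = monoDeg F q + monoDeg F r := by
      rw [monoDeg, monoDeg, monoDeg, ← Finset.sum_add_distrib]
      refine Finset.sum_congr rfl fun i _ => ?_
      have hi := fun hq => Finset.disjoint_left.1 h (show i.castSucc ∈ q.2 from hq)
      by_cases h1 : i.castSucc ∈ q.2 <;> by_cases h2 : i.castSucc ∈ r.2 <;> simp_all <;> ring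
    rw [hdeg]
    ring
  · simp [koszul, h]

theorem De_Deg (i : Fin n) (f : SAlg F n (n + 1)) : De i (Deg f) = Deg (De i f) + De i f := by
  induction f using mono_induction with
  | hadd f f' hf hf' => simp only [Deg_add, De_add, hf, hf']; abel
  | hsmul c f hf => simp only [Deg_smul, De_smul, hf, smul_add]
  | hmono q =>
    simp only [Deg_mono, De_mono, De_smul, Deg_smul, smul_smul, ← add_smul]
    congr 1
    split_ifs with h
    · have hdeg : monoDeg F q = monoDeg F (Function.update q.1 i (q.1 i - 1), q.2) + 1 := by
        rw [monoDeg, monoDeg, ← Fintype.sum_ite_eq' i fun _ => (1 : F), ← Finset.sum_add_distrib]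
        refine Finset.sum_congr rfl fun k _ => ?_
        rcases eq_or_ne k i with rfl | hk
        · simp only [Function.update_self, if_true, Nat.cast_pred h]; ring
        · simp [hk]
      rw [hdeg]
      ring
    · simp

theorem Do_castSucc_Deg (j : Fin n) (f : SAlg F n (n + 1)) :
    Do j.castSucc (Deg f) = Deg (Do j.castSucc f) + Do j.castSucc f := by
  induction f using mono_induction with
  | hadd f f' hf hf' => simp only [Deg_add, Do_add, hf, hf']; abel
  | hsmul c f hf => simp only [Deg_smul, Do_smul, hf, smul_add]
  | hmono q =>
    simp only [Deg_mono, Do_mono, Do_smul, Deg_smul, smul_smul, ← add_smul]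
    congr 1
    split_ifs with h
    · have hdeg : monoDeg F q = monoDeg F (q.1, q.2.erase j.castSucc) + 1 := by
        rw [monoDeg, monoDeg, ← Fintype.sum_ite_eq' j fun _ => (1 : F), ← Finset.sum_add_distrib]
        refine Finset.sum_congr rfl fun k _ => ?_
        rcases eq_or_ne k j with rfl | hk
        · simp [h]
        · simp [hk]
      rw [hdeg]
      ring
    · simp

theorem Dlast_Deg (f : SAlg F n (n + 1)) : Dlast (Deg f) = Deg (Dlast f) := by
  unfold Dlast
  induction f using mono_induction with
  | hadd f f' hf hf' => simp only [Deg_add, Do_add, hf, hf']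
  | hsmul c f hf => simp only [Deg_smul, Do_smul, hf]
  | hmono q =>
    have hdeg : monoDeg F (q.1, q.2.erase (Fin.last n)) = monoDeg F q := by
      refine Finset.sum_congr rfl fun k _ => ?_
      simp
    simp only [Deg_mono, Do_mono, Do_smul, Deg_smul, smul_smul, hdeg, mul_comm]

end derivations

section bracket

lemma sgn_zero : sgn F 0 = 1 := if_pos rfl

lemma sgn_one : sgn F 1 = -1 := if_neg one_ne_zero

lemma zmod_two_one_add_one : (1 + 1 : ZMod 2) = 0 := by decide

lemma zmod_two_cases : ∀ c : ZMod 2, c = 0 ∨ c = 1 := by decide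

lemma sMul_left_comm {c d : ZMod 2} {f g : SAlg F n n'} (hf : IsHomog c f) (hg : IsHomog d g)
    (h : SAlg F n n') : sMul f (sMul g h) = sgn F (c * d) • sMul g (sMul f h) := by
  rw [← sMul_assoc, sMul_comm_of_isHomog hf hg, smul_sMul, sMul_assoc]

lemma TH'_eq_sum (c : ZMod 2) (a b : SAlg F n (n + 1)) :
    TH' c a b = ∑ i : Fin n, (sMul (De i a) (Do i.castSucc b) +
      sgn F c • sMul (Do i.castSucc a) (De i b)) := by
  rw [TH', Finset.smul_sum, Finset.sum_add_distrib]

@[simp] lemma TH'_add (c : ZMod 2) (a b b' : SAlg F n (n + 1)) :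
    TH' c a (b + b') = TH' c a b + TH' c a b' := by
  simp only [TH'_eq_sum, ← Finset.sum_add_distrib]
  refine Finset.sum_congr rfl fun i _ => ?_
  simp only [Do_add, De_add, sMul_add]
  module

@[simp] lemma TH'_smul (c : ZMod 2) (d : F) (a b : SAlg F n (n + 1)) :
    TH' c a (d • b) = d • TH' c a b := by
  simp only [TH'_eq_sum, Finset.smul_sum]
  refine Finset.sum_congr rfl fun i _ => ?_
  simp only [Do_smul, De_smul, sMul_smul]
  module

@[simp] lemma TH'_sub (c : ZMod 2) (a b b' : SAlg F n (n + 1)) :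
    TH' c a (b - b') = TH' c a b - TH' c a b' := by
  rw [sub_eq_add_neg, ← neg_one_smul F b', TH'_add, TH'_smul, neg_one_smul, sub_eq_add_neg]

@[simp] lemma add_TH' (c : ZMod 2) (a a' b : SAlg F n (n + 1)) :
    TH' c (a + a') b = TH' c a b + TH' c a' b := by
  simp only [TH'_eq_sum, ← Finset.sum_add_distrib]
  refine Finset.sum_congr rfl fun i _ => ?_
  simp only [Do_add, De_add, add_sMul]
  module

@[simp] lemma smul_TH' (c : ZMod 2) (d : F) (a b : SAlg F n (n + 1)) :
    TH' c (d • a) b = d • TH' c a b := by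
  simp only [TH'_eq_sum, Finset.smul_sum]
  refine Finset.sum_congr rfl fun i _ => ?_
  simp only [Do_smul, De_smul, smul_sMul]
  module

@[simp] lemma sub_TH' (c : ZMod 2) (a a' b : SAlg F n (n + 1)) :
    TH' c (a - a') b = TH' c a b - TH' c a' b := by
  rw [sub_eq_add_neg, ← neg_one_smul F a', add_TH', smul_TH', neg_one_smul, sub_eq_add_neg]

variable {c d : ZMod 2} {a b : SAlg F n (n + 1)}

lemma IsHomog.dlast (ha : IsHomog c a) : IsHomog (c + 1) (Dlast a) := ha.odd_deriv _

theorem TH'_sMul (ha : IsHomog c a) (hb : IsHomog d b) (x : SAlg F n (n + 1)) :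
    TH' c a (sMul b x) = sMul (TH' c a b) x + sgn F ((c + 1) * d) • sMul b (TH' c a x) := by
  simp only [TH'_eq_sum, sum_sMul, sMul_sum, Finset.smul_sum, ← Finset.sum_add_distrib]
  refine Finset.sum_congr rfl fun i _ => ?_
  simp only [De_sMul, Do_sMul hb, sMul_add, sMul_smul, add_sMul, smul_sMul, sMul_assoc,
    sMul_left_comm hb (ha.even_deriv i), sMul_left_comm hb (ha.odd_deriv i.castSucc)]
  rcases zmod_two_cases c with rfl | rfl <;> rcases zmod_two_cases d with rfl | rfl <;>
    simp only [zero_add, mul_zero, mul_one, zmod_two_one_add_one,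
      sgn_zero, sgn_one] <;>
    module

theorem sMul_TH' (ha : IsHomog c a) (hb : IsHomog d b) (x : SAlg F n (n + 1)) :
    TH' (c + d) (sMul a b) x = sMul a (TH' d b x) + sgn F (c * d) • sMul b (TH' c a x) := by
  simp only [TH'_eq_sum, sMul_sum, Finset.smul_sum, ← Finset.sum_add_distrib]
  refine Finset.sum_congr rfl fun i _ => ?_
  simp only [De_sMul, Do_sMul ha, sMul_add, sMul_smul, add_sMul, smul_sMul, sMul_assoc,
    sMul_left_comm hb (ha.even_deriv i), sMul_left_comm hb (ha.odd_deriv i.castSucc)]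
  rcases zmod_two_cases c with rfl | rfl <;> rcases zmod_two_cases d with rfl | rfl <;>
    simp only [zero_add, add_zero, mul_zero, mul_one, zmod_two_one_add_one,
      sgn_zero, sgn_one] <;>
    module

theorem TH'_comm (ha : IsHomog c a) (hb : IsHomog d b) :
    TH' c a b = -sgn F ((c + 1) * (d + 1)) • TH' d b a := by
  simp only [TH'_eq_sum, Finset.smul_sum]
  refine Finset.sum_congr rfl fun i _ => ?_
  rw [sMul_comm_of_isHomog (ha.even_deriv i) (hb.odd_deriv i.castSucc),
    sMul_comm_of_isHomog (ha.odd_deriv i.castSucc) (hb.even_deriv i)]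
  rcases zmod_two_cases c with rfl | rfl <;> rcases zmod_two_cases d with rfl | rfl <;>
    simp only [zero_add, mul_zero, mul_one, zmod_two_one_add_one,
      sgn_zero, sgn_one] <;>
    module

theorem Deg_TH' (c : ZMod 2) (a b : SAlg F n (n + 1)) :
    Deg (TH' c a b) = TH' c (Deg a) b + TH' c a (Deg b) - (2 : F) • TH' c a b := by
  simp only [TH'_eq_sum, Deg_sum, Finset.smul_sum, ← Finset.sum_add_distrib,
    ← Finset.sum_sub_distrib]
  refine Finset.sum_congr rfl fun i _ => ?_
  simp only [Deg_add, Deg_smul, Deg_sMul, De_Deg, Do_castSucc_Deg, sMul_add, add_sMul]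
  module

theorem Dlast_TH' (ha : IsHomog c a) (b : SAlg F n (n + 1)) :
    Dlast (TH' c a b) = TH' (c + 1) (Dlast a) b - sgn F c • TH' c a (Dlast b) := by
  simp only [Dlast, TH'_eq_sum, Do_sum, Finset.smul_sum, ← Finset.sum_sub_distrib]
  refine Finset.sum_congr rfl fun i _ => ?_
  simp only [Do_add, Do_smul, Do_sMul (ha.even_deriv i), Do_sMul (ha.odd_deriv i.castSucc), Do_De,
    Do_anticomm (Fin.last n) i.castSucc, sMul_neg, neg_sMul]
  rcases zmod_two_cases c with rfl | rfl <;>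
    simp only [zero_add, zmod_two_one_add_one, sgn_zero, sgn_one] <;>
    module

theorem TH'_jacobi (ha : IsHomog c a) (hb : IsHomog d b) (x : SAlg F n (n + 1)) :
    TH' c a (TH' d b x) - sgn F ((c + 1) * (d + 1)) • TH' d b (TH' c a x) =
      TH' (c + d + 1) (TH' c a b) x := by
  let G : Fin n → Fin n → SAlg F n (n + 1) := fun i j =>
    sgn F d • sMul (De i a) (sMul (De j b) (Do i.castSucc (Do j.castSucc x))) -
    sMul (De i a) (sMul (Do j.castSucc b) (De j (Do i.castSucc x))) +
    sgn F c • sMul (Do i.castSucc a) (sMul (De j b) (De i (Do j.castSucc x))) +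
    (sgn F c * sgn F d) • sMul (Do i.castSucc a) (sMul (Do j.castSucc b) (De i (De j x)))
  have hG : ∑ i, ∑ j, (G i j - G j i) = 0 := by
    simp only [Finset.sum_sub_distrib]
    rw [Finset.sum_comm, sub_self]
  rw [← sub_eq_zero, ← hG]
  have hR : TH' (c + d + 1) (TH' c a b) x = ∑ i, ∑ j : Fin n,
      (sMul (De j (sMul (De i a) (Do i.castSucc b) + sgn F c • sMul (Do i.castSucc a) (De i b)))
        (Do j.castSucc x) + sgn F (c + d + 1) • sMul (Do j.castSucc
        (sMul (De i a) (Do i.castSucc b) + sgn F c • sMul (Do i.castSucc a) (De i b)))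
        (De j x)) := by
    rw [Finset.sum_comm]
    simp only [TH'_eq_sum, De_sum, Do_sum, sum_sMul, Finset.smul_sum, ← Finset.sum_add_distrib]
  rw [hR]
  simp only [TH'_eq_sum, De_sum, Do_sum, sMul_sum, Finset.smul_sum, ← Finset.sum_add_distrib,
    ← Finset.sum_sub_distrib]
  refine Finset.sum_congr rfl fun i _ => Finset.sum_congr rfl fun j _ => ?_
  simp only [G, De_add, De_smul, Do_add, Do_smul, De_sMul, Do_De,
    Do_sMul (ha.even_deriv _), Do_sMul (ha.odd_deriv _), Do_sMul (hb.even_deriv _),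
    Do_sMul (hb.odd_deriv _), sMul_add, sMul_smul, add_sMul, smul_sMul, sMul_assoc,
    sMul_left_comm (hb.even_deriv _) (ha.even_deriv _),
    sMul_left_comm (hb.even_deriv _) (ha.odd_deriv _),
    sMul_left_comm (hb.odd_deriv _) (ha.even_deriv _),
    sMul_left_comm (hb.odd_deriv _) (ha.odd_deriv _),
    sMul_left_comm (hb.even_deriv _) ((ha.odd_deriv _).even_deriv _),
    sMul_left_comm (hb.odd_deriv _) ((ha.even_deriv _).even_deriv _),
    sMul_left_comm (hb.odd_deriv _) ((ha.odd_deriv _).even_deriv _),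
    sMul_left_comm (hb.even_deriv _) ((ha.odd_deriv _).odd_deriv _),
    De_comm j i, Do_anticomm j.castSucc i.castSucc, sMul_neg, neg_sMul]
  rcases zmod_two_cases c with rfl | rfl <;> rcases zmod_two_cases d with rfl | rfl <;>
    simp only [zero_add, add_zero, mul_zero, mul_one, zmod_two_one_add_one,
      sgn_zero, sgn_one] <;>
    module

lemma Dlast_add (a b : SAlg F n (n + 1)) : Dlast (a + b) = Dlast a + Dlast b := Do_add _ a b

lemma Dlast_sub (a b : SAlg F n (n + 1)) : Dlast (a - b) = Dlast a - Dlast b := Do_sub _ a b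

lemma Dlast_smul (r : F) (a : SAlg F n (n + 1)) : Dlast (r • a) = r • Dlast a := Do_smul _ r a

lemma Dlast_Dlast (a : SAlg F n (n + 1)) : Dlast (Dlast a) = 0 := Do_Do_self _ a

lemma Dlast_sMul (ha : IsHomog c a) (b : SAlg F n (n + 1)) :
    Dlast (sMul a b) = sMul (Dlast a) b + sgn F c • sMul a (Dlast b) := Do_sMul ha _ b

lemma TK_eq (c : ZMod 2) (a b : SAlg F n (n + 1)) :
    TK c a b = TH' c a b + sgn F c • sMul (Dlast a) (Deg b) + sMul (Deg a) (Dlast b) -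
      (2 : F) • sMul a (Dlast b) := by
  rw [TK, ← Nat.cast_smul_eq_nsmul F, Nat.cast_ofNat, sub_sMul, smul_sMul, add_sub_assoc]

theorem TK_bracket (ha : IsHomog c a) (hb : IsHomog d b) (x : SAlg F n (n + 1)) :
    TK c a (TK d b x) - sgn F ((c + 1) * (d + 1)) • TK d b (TK c a x) =
      TK (c + d + 1) (TK c a b - sgn F c • (2 : F) • sMul (Dlast a) b) x := by
  have hmul : ∀ {c' d' : ZMod 2} {f g : SAlg F n (n + 1)}, IsHomog c' f → IsHomog d' g →
      c + d + 1 = c' + d' → ∀ y, TH' (c + d + 1) (sMul f g) y =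
        sMul f (TH' d' g y) + sgn F (c' * d') • sMul g (TH' c' f y) :=
    fun hf hg h y => by rw [h, sMul_TH' hf hg]
  have h1 : c + d + 1 = (c + 1) + d := add_right_comm c d 1
  have h2 : c + d + 1 = c + (d + 1) := add_assoc c d 1
  have hjac : ∀ y, TH' c a (TH' d b y) = TH' (c + d + 1) (TH' c a b) y +
      sgn F ((c + 1) * (d + 1)) • TH' d b (TH' c a y) :=
    fun y => by rw [← TH'_jacobi ha hb]; abel
  simp only [TK_eq, TH'_add, TH'_sub, TH'_smul, add_TH', sub_TH', smul_TH', sMul_add, sMul_sub,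
    sMul_smul, add_sMul, sub_sMul, smul_sMul, Deg_add, Deg_sub, Deg_smul, Dlast_add, Dlast_sub,
    Dlast_smul, Deg_TH', Dlast_TH' ha, Dlast_TH' hb, Deg_sMul, Dlast_Deg, Dlast_Dlast,
    Dlast_sMul ha, Dlast_sMul ha.deg, Dlast_sMul ha.dlast,
    Dlast_sMul hb, Dlast_sMul hb.deg, Dlast_sMul hb.dlast,
    TH'_sMul ha hb, TH'_sMul ha hb.deg, TH'_sMul ha hb.dlast,
    TH'_sMul hb ha, TH'_sMul hb ha.deg, TH'_sMul hb ha.dlast,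
    hmul ha.dlast hb h1, hmul ha.dlast hb.deg h1, hmul ha hb.dlast h2, hmul ha.deg hb.dlast h2,
    TH'_comm hb ha, TH'_comm hb ha.deg, TH'_comm hb ha.dlast, hjac, sMul_assoc,
    sMul_zero, zero_sMul,
    sMul_left_comm hb ha.dlast, sMul_left_comm hb ha.dlast.deg, sMul_left_comm hb.deg ha.dlast,
    sMul_left_comm hb.deg ha.dlast.deg, sMul_left_comm hb.dlast ha, sMul_left_comm hb.dlast ha.deg,
    sMul_left_comm hb.dlast ha.dlast, sMul_left_comm hb.dlast ha.dlast.deg,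
    sMul_left_comm hb.dlast ha.deg.deg]
  rcases zmod_two_cases c with rfl | rfl <;> rcases zmod_two_cases d with rfl | rfl <;>
    simp only [zero_add, add_zero, mul_zero, mul_one, zmod_two_one_add_one,
      sgn_zero, sgn_one] <;>
    module

end bracket

/-- The odd contact bracket formula: for homogeneous `a, b ∈ 𝒪(n, n+1; t̲)`,
`[T_K(a), T_K(b)] = T_K(T_K(a)(b) - (-1)^{p(a)} 2 ∂_{2n+1}(a) b)`, where the
bracket is the supercommutator (`T_K(a)` has parity `p(a) + 1`). -/
theorem stmt15 (p : ℕ) (hp : p.Prime) (hp3 : 3 < p) [CharP F p]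
    (t : Fin n → ℕ) (ht : ∀ i, 0 < t i)
    (pa pb : ZMod 2) (a b : SAlg F n (n + 1))
    (ha : IsHomog pa a) (hb : IsHomog pb b)
    (hba : Bounded p t a) (hbb : Bounded p t b) :
    ∀ x : SAlg F n (n + 1),
      TK pa a (TK pb b x) - sgn F ((pa + 1) * (pb + 1)) • TK pb b (TK pa a x)
        = TK (pa + pb + 1)
            (TK pa a b - sgn F pa • (2 : F) • sMul (Dlast a) b) x :=
  TK_bracket ha hb

end
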